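/- Let n ≥ 1 and β > 0, let A_ESO be the (n+1)×(n+1) real upper shift matrix, c = e₁ the first standard basis vector of ℝ^{n+1}, and l_BW ∈ ℝ^{n+1} the bandwidth-parameterization observer gain vector at β. Then the half-gain observer error characteristic polynomial satisfies det(λI − (A_ESO − (1/2) l_BW cᵀ)) = (1/2)(λ^{n+1} + (λ + β)^{n+1}) as polynomials in λ; consequently every eigenvalue of A_ESO − (1/2) l_BW cᵀ has real part −β/2. -/

import Mathlib

open Matrix Polynomial

/-- The `m × m` upper shift matrix: `A i j = 1` if `j = i + 1`, else `0`. -/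
noncomputable def shiftMat (m : ℕ) : Matrix (Fin m) (Fin m) ℝ :=
  Matrix.of fun i j => if (j : ℕ) = (i : ℕ) + 1 then 1 else 0

/-- The first standard basis vector `e₁` of `ℝᵐ`. -/
noncomputable def firstVec (m : ℕ) : Fin m → ℝ :=
  fun i => if (i : ℕ) = 0 then 1 else 0

/-- Bandwidth-parameterization observer gains: the 1-based gain
`l_i = C(n+1, i) β^i`; with 0-based index `j : Fin (n+1)` this is
`l j = C(n+1, j+1) β^(j+1)`. -/
noncomputable def lBW (n : ℕ) (β : ℝ) : Fin (n + 1) → ℝ :=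
  fun j => ((n + 1).choose ((j : ℕ) + 1)) * β ^ ((j : ℕ) + 1)

/-- Determinant of the matrix with first column `b`, diagonal entries `x` and superdiagonal
entries `-1` outside the first column. -/
theorem det_firstCol_shift {R : Type*} [CommRing R] (x : R) (m : ℕ) (b : ℕ → R) :
    (Matrix.of fun i j : Fin (m + 1) =>
        if (j : ℕ) = 0 then b i else if (j : ℕ) = i then x
          else if (j : ℕ) = i + 1 then -1 else 0).det
      = ∑ i ∈ Finset.range (m + 1), b i * x ^ (m - i) := by
  induction m generalizing b with
  | zero => simp
  | succ m ih =>
    rw [Matrix.det_succ_row_zero, Fin.sum_univ_succ, Fin.sum_univ_succ,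
      Finset.sum_eq_zero (s := (Finset.univ : Finset (Fin m))), Finset.sum_range_succ']
    · have h0 : (Matrix.submatrix (Matrix.of fun i j : Fin (m + 1 + 1) =>
          if (j : ℕ) = 0 then b i else if (j : ℕ) = i then x
            else if (j : ℕ) = i + 1 then -1 else 0) Fin.succ (Fin.succAbove 0)).det
          = x ^ (m + 1) := by
        rw [Matrix.det_of_isUpperTriangular]
        · simp
        · intro i j hij
          have hij' : (j : ℕ) < i := hij
          simp only [Matrix.submatrix_apply, Matrix.of_apply, Fin.zero_succAbove, Fin.val_succ]
          rw [if_neg (by lia), if_neg (by lia), if_neg (by lia)]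
      have h1 : Matrix.submatrix (Matrix.of fun i j : Fin (m + 1 + 1) =>
          if (j : ℕ) = 0 then b i else if (j : ℕ) = i then x
            else if (j : ℕ) = i + 1 then -1 else 0) Fin.succ
              (Fin.succAbove (Fin.succ (0 : Fin (m + 1))))
          = Matrix.of fun i j : Fin (m + 1) =>
            if (j : ℕ) = 0 then b (i + 1) else if (j : ℕ) = i then x
              else if (j : ℕ) = i + 1 then -1 else 0 := by
        ext i j
        refine Fin.cases ?_ (fun k => ?_) j <;> simp
      rw [h0, h1, ih (fun i => b (i + 1))]
      simp
      ring
    · intro k _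
      simp

/-- The characteristic polynomial of the observer matrix with gain `l`. -/
theorem charpoly_shiftMat_sub_vecMulVec (n : ℕ) (l : ℕ → ℝ) :
    (shiftMat (n + 1) - vecMulVec (fun i : Fin (n + 1) => l i) (firstVec (n + 1))).charpoly
      = X ^ (n + 1) + ∑ i ∈ Finset.range (n + 1), C (l i) * X ^ (n - i) := by
  have h := det_firstCol_shift (X : ℝ[X]) n (fun i => (if i = 0 then X else 0) + C (l i))
  have hM : (shiftMat (n + 1) -
      vecMulVec (fun i : Fin (n + 1) => l i) (firstVec (n + 1))).charmatrix
      = Matrix.of fun i j : Fin (n + 1) =>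
        if (j : ℕ) = 0 then (if (i : ℕ) = 0 then X else 0) + C (l i) else if (j : ℕ) = i then X
          else if (j : ℕ) = i + 1 then -1 else 0 := by
    ext1 i j
    simp only [Matrix.charmatrix_apply, Matrix.diagonal_apply, Matrix.sub_apply, shiftMat,
      firstVec, Matrix.vecMulVec_apply, Matrix.of_apply, Fin.ext_iff]
    split_ifs <;> first | lia | simp
  rw [Matrix.charpoly, hM, h]
  simp only [add_mul, Finset.sum_add_distrib]
  simp [pow_succ']

/-- Complex numbers equidistant from `0` and `-β` have real part `-β / 2`. -/
theorem re_eq_neg_half_of_norm_eq {β : ℝ} (hβ : β ≠ 0) {z : ℂ} (h : ‖z‖ = ‖z + β‖) :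
    z.re = -β / 2 := by
  have h2 : Complex.normSq z = Complex.normSq (z + β) := by
    rw [Complex.normSq_eq_norm_sq, Complex.normSq_eq_norm_sq, h]
  simp only [Complex.normSq_apply, Complex.add_re, Complex.add_im, Complex.ofReal_re,
    Complex.ofReal_im] at h2
  apply mul_left_cancel₀ hβ
  linarith

/-- The half-gain observer error characteristic polynomial is
`det(λI - (A_ESO - (1/2) l_BW cᵀ)) = (1/2)(λ^(n+1) + (λ + β)^(n+1))`;
consequently every eigenvalue of `A_ESO - (1/2) l_BW cᵀ` (of the complexification)
has real part `-β/2`. -/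
theorem half_gain_observer_charpoly_and_eigs (n : ℕ) (hn : 1 ≤ n) (β : ℝ) (hβ : 0 < β) :
    (shiftMat (n + 1) - (1 / 2 : ℝ) • vecMulVec (lBW n β) (firstVec (n + 1))).charpoly
        = C (1 / 2 : ℝ) * (X ^ (n + 1) + (X + C β) ^ (n + 1))
    ∧ ∀ z ∈ spectrum ℂ
        ((shiftMat (n + 1) - (1 / 2 : ℝ) • vecMulVec (lBW n β) (firstVec (n + 1))).map
          Complex.ofReal), z.re = -β / 2 := by
  have hchar :
      (shiftMat (n + 1) - (1 / 2 : ℝ) • vecMulVec (lBW n β) (firstVec (n + 1))).charpoly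
        = C (1 / 2 : ℝ) * (X ^ (n + 1) + (X + C β) ^ (n + 1)) := by
    have h := charpoly_shiftMat_sub_vecMulVec n
      (fun i => (1 / 2 : ℝ) * (((n + 1).choose (i + 1)) * β ^ (i + 1)))
    have hv : (fun i : Fin (n + 1) =>
        (1 / 2 : ℝ) * (((n + 1).choose ((i : ℕ) + 1)) * β ^ ((i : ℕ) + 1)))
        = (1 / 2 : ℝ) • lBW n β := rfl
    rw [hv, Matrix.smul_vecMulVec] at h
    rw [h, add_comm X (C β), add_pow, Finset.sum_range_succ' _ (n + 1)]
    have hs : ∀ i ∈ Finset.range (n + 1),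
        C ((1 / 2 : ℝ) * (((n + 1).choose (i + 1)) * β ^ (i + 1))) * X ^ (n - i)
        = C (1 / 2 : ℝ) * (C β ^ (i + 1) * X ^ (n + 1 - (i + 1)) *
          ((n + 1).choose (i + 1) : ℝ[X])) := by
      intro i _
      rw [Nat.add_sub_add_right, C_mul, C_mul, C_pow, C_eq_natCast]
      ring
    rw [Finset.sum_congr rfl hs, ← Finset.mul_sum]
    have h2 : (C (1 / 2 : ℝ)) + C (1 / 2 : ℝ) = 1 := by
      rw [← C_add]; norm_num
    simp only [pow_zero, Nat.choose_zero_right, Nat.sub_zero, Nat.cast_one]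
    linear_combination (-X ^ (n + 1)) * h2
  refine ⟨hchar, fun z hz => re_eq_neg_half_of_norm_eq hβ.ne' ?_⟩
  have hroot := Matrix.mem_spectrum_iff_isRoot_charpoly.mp hz
  rw [show Complex.ofReal = ⇑Complex.ofRealHom from rfl, Matrix.charpoly_map, hchar] at hroot
  have hz' : z ^ (n + 1) + (z + β) ^ (n + 1) = 0 := by
    simpa [Polynomial.IsRoot] using hroot
  have hnorm : ‖z‖ ^ (n + 1) = ‖z + β‖ ^ (n + 1) := by
    rw [← norm_pow, ← norm_pow, eq_neg_of_add_eq_zero_left hz', norm_neg]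
  exact (pow_left_inj₀ (norm_nonneg _) (norm_nonneg _) n.succ_ne_zero).mp hnorm
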